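/- Let A = (1, 4, 9, ...) be the sequence of perfect squares, a_k = k². For all integers n ≥ 1, the scoreboard value A^φ(n) = φ(1+φ(4+φ(9+...+φ(n²)...))) equals: 1 if n = 1; 2 if n = 2; 4 if n = 3; 6 if n ∈ {4,5,6}; 22 if n ∈ {9,14,15,17,24,26,30,31,32,33,34,35,38,40,47,53,59,69}; and 16 for all other n. -/

import Mathlib

/-- `scorePartial a n j` is the partial evaluation `A^φ(n, n - j)` of the
adversarial totient iteration for the sequence `a` (indexed from 1):
`scorePartial a n 0 = 0` corresponds to `A^φ(n,n) = 0`, and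
`scorePartial a n (j+1) = φ(a (n-j) + scorePartial a n j)` corresponds to the
recurrence `A^φ(n,k-1) = φ(a_k + A^φ(n,k))` with `k = n - j`.
Hence `A^φ(n,k) = scorePartial a n (n - k)`, and the scoreboard function is
`A^φ(n) = A^φ(n,0) = scorePartial a n n`. -/
def scorePartial (a : ℕ → ℕ) (n : ℕ) : ℕ → ℕ
  | 0 => 0
  | j + 1 => Nat.totient (a (n - j) + scorePartial a n j)

/-- Evaluates `f n`, with `n` in the position of a recursion argument, so that kernel reduction
normalises `n` to a literal first. -/
def evalAt {α : Type} (n : ℕ) (f : ℕ → α) : α :=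
  match n with
  | 0 => f 0
  | k + 1 => f (k + 1)

theorem evalAt_eq {α : Type} (n : ℕ) (f : ℕ → α) : evalAt n f = f n := by
  cases n <;> rfl

/-- The product of the primes below `257`. -/
def smallPrimeProduct : ℕ :=
  64266330917908644872330635228106713310880186591609208114244758680898150367880703152525200743234420230

theorem dvd_smallPrimeProduct {r : ℕ} (hr : r.Prime) (h : r < 257) : r ∣ smallPrimeProduct := by
  have hfac : Nat.factorial 256 ∣ smallPrimeProduct ^ 256 :=
    Nat.dvd_of_mod_eq_zero (by decide +kernel)
  exact hr.dvd_of_dvd_pow ((hr.dvd_factorial.2 (by omega)).trans hfac)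

/-- Totient by trial division with `fuel` steps, for `m` without prime factors below `p`. -/
def trialTotient : ℕ → ℕ → ℕ → ℕ
  | 0, _, m => Nat.totient m
  | fuel + 1, p, m =>
    bif Nat.blt m (p * p) || (Nat.beq (Nat.gcd m smallPrimeProduct) 1 && Nat.blt m 66049) then
      (bif Nat.beq m 1 then 1 else m - 1)
    else bif Nat.beq (m % p) 0 then
      evalAt (m / p) fun q =>
        bif Nat.beq (q % p) 0 then p * trialTotient fuel p q
        else evalAt (p + 1 + p % 2) fun p' => (p - 1) * trialTotient fuel p' q
    else evalAt (p + 1 + p % 2) fun p' => trialTotient fuel p' m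

theorem prime_of_dvd_of_forall_prime_le {p m : ℕ} (hp : 2 ≤ p) (hpm : p ∣ m)
    (h : ∀ r, r.Prime → r ∣ m → p ≤ r) : p.Prime :=
  Nat.prime_def_minFac.2 ⟨hp, (Nat.minFac_le (by omega)).antisymm
    (h _ (Nat.minFac_prime (by omega)) ((Nat.minFac_dvd p).trans hpm))⟩

theorem next_candidate_le {p m : ℕ} (hp : 2 ≤ p) (hpm : ¬ p ∣ m)
    (h : ∀ r, r.Prime → r ∣ m → p ≤ r) : ∀ r, r.Prime → r ∣ m → p + 1 + p % 2 ≤ r := by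
  intro r hr hrm
  have h1 := h r hr hrm
  have h2 : r ≠ p := by rintro rfl; exact hpm hrm
  rcases hr.eq_two_or_odd with h3 | h3 <;> omega

theorem trialTotient_eq (fuel : ℕ) : ∀ p m : ℕ, 2 ≤ p → 1 ≤ m →
    (∀ r, r.Prime → r ∣ m → p ≤ r) → trialTotient fuel p m = Nat.totient m := by
  induction fuel with
  | zero => intro p m _ _ _; rfl
  | succ fuel ih =>
    intro p m hp hm h
    simp only [trialTotient, evalAt_eq, Bool.cond_eq_ite, Bool.or_eq_true, Bool.and_eq_true,
      Nat.beq_eq, Nat.blt_eq]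
    split_ifs with h1 h2 h3 h4
    · simp [h2]
    · have hmp : m.Prime := by
        by_contra hnp
        have h5 := Nat.minFac_sq_le_self hm hnp
        have h6 := h _ (Nat.minFac_prime h2) (Nat.minFac_dvd m)
        rcases h1 with h1 | ⟨hgcd, hlt⟩
        · nlinarith
        · have h7 : m.minFac < 257 := by nlinarith
          have h8 := Nat.dvd_gcd (Nat.minFac_dvd m)
            (dvd_smallPrimeProduct (Nat.minFac_prime h2) h7)
          rw [hgcd, Nat.dvd_one, Nat.minFac_eq_one_iff] at h8
          exact h2 h8
      exact (Nat.totient_prime hmp).symm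
    · obtain ⟨q, rfl⟩ := Nat.dvd_of_mod_eq_zero h3
      rw [Nat.mul_div_cancel_left _ (by omega)] at *
      have hpp := prime_of_dvd_of_forall_prime_le hp (dvd_mul_right p q) h
      rw [Nat.totient_mul_of_prime_of_dvd hpp (Nat.dvd_of_mod_eq_zero h4),
        ih p q hp (Nat.pos_of_mul_pos_left hm) fun r hr hrq => h r hr (hrq.mul_left p)]
    · obtain ⟨q, rfl⟩ := Nat.dvd_of_mod_eq_zero h3
      rw [Nat.mul_div_cancel_left _ (by omega)] at *
      have hpp := prime_of_dvd_of_forall_prime_le hp (dvd_mul_right p q) h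
      have hpq : ¬ p ∣ q := fun hd => h4 (Nat.mod_eq_zero_of_dvd hd)
      rw [Nat.totient_mul_of_prime_of_not_dvd hpp hpq,
        ih _ q (by omega) (Nat.pos_of_mul_pos_left hm)
          (next_candidate_le hp hpq fun r hr hrq => h r hr (hrq.mul_left p))]
    · exact ih _ m (by omega) hm
        (next_candidate_le hp (fun hd => h3 (Nat.mod_eq_zero_of_dvd hd)) h)

/-- A version of `Nat.totient` that the kernel evaluates quickly. -/
def fastTotient (m : ℕ) : ℕ := evalAt m fun m => trialTotient 300 2 m

theorem fastTotient_eq {m : ℕ} (hm : 1 ≤ m) : fastTotient m = Nat.totient m := by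
  rw [fastTotient, evalAt_eq]
  exact trialTotient_eq _ _ _ le_rfl hm fun r hr _ => hr.two_le

/-- Adds to the bit set `acc >>> 16` the elements `φ (c + lo + x)` for all `x < 2 ^ d` in the bit
set `block`. The low 16 bits of `acc` hold the last `lo`, which keeps the hashes of the literals
met by the kernel apart. -/
def totientImageAux (c : ℕ) : ℕ → ℕ → ℕ → ℕ → ℕ
  | 0, lo, block, acc => bif Nat.beq block 0 then acc else
      (acc >>> 16 ||| 1 <<< fastTotient (c + lo)) <<< 16 ||| lo
  | d + 1, lo, block, acc =>
    bif Nat.beq block 0 then acc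
    else
      evalAt (block % 2 ^ 2 ^ d) fun low =>
      evalAt (block >>> 2 ^ d) fun high =>
      evalAt (lo + 2 ^ d) fun mid =>
      evalAt (totientImageAux c d lo low acc) fun acc' => totientImageAux c d mid high acc'

theorem testBit_totientImageAux_of_acc (c d : ℕ) : ∀ lo block acc v, acc.testBit (16 + v) = true →
    (totientImageAux c d lo block acc).testBit (16 + v) = true := by
  induction d with
  | zero =>
    intro lo block acc v h
    rw [totientImageAux, Bool.cond_eq_ite]
    split_ifs
    · exact h
    · simp [h]
  | succ d ih =>
    intro lo block acc v h
    simp only [totientImageAux, Bool.cond_eq_ite, evalAt_eq]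
    split_ifs
    · exact h
    · exact ih _ _ _ _ (ih _ _ _ _ h)

theorem testBit_totientImageAux (c d : ℕ) (hc : 1 ≤ c) : ∀ lo block acc x, x < 2 ^ d →
    block.testBit x = true →
    (totientImageAux c d lo block acc).testBit (16 + Nat.totient (c + lo + x)) = true := by
  induction d with
  | zero =>
    intro lo block acc x hx h
    have hb : block ≠ 0 := by rintro rfl; simp at h
    obtain rfl : x = 0 := by simpa using hx
    simp [totientImageAux, Bool.cond_eq_ite, hb, fastTotient_eq (show 1 ≤ c + lo by omega),
      Nat.testBit_shiftLeft]
  | succ d ih =>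
    intro lo block acc x hx h
    have hb : block ≠ 0 := by rintro rfl; simp at h
    simp only [totientImageAux, Bool.cond_eq_ite, evalAt_eq, Nat.beq_eq, if_neg hb]
    by_cases hxd : x < 2 ^ d
    · exact testBit_totientImageAux_of_acc _ _ _ _ _ _ (ih _ _ _ _ hxd (by simp [hxd, h]))
    · have hx' : x - 2 ^ d < 2 ^ d := by rw [pow_succ] at hx; omega
      have := ih (lo + 2 ^ d) (block >>> 2 ^ d) (totientImageAux c d lo (block % 2 ^ 2 ^ d) acc)
        (x - 2 ^ d) hx'
        (by rwa [Nat.testBit_shiftRight, show 2 ^ d + (x - 2 ^ d) = x by omega])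
      rwa [show c + (lo + 2 ^ d) + (x - 2 ^ d) = c + lo + x by omega] at this

/-- The bit set of `{0, 2, …, 2 * (n - 1)}`. -/
def evenBits (n : ℕ) : ℕ := (4 ^ n - 1) / 3

theorem testBit_evenBits (n : ℕ) : ∀ i < n, (evenBits n).testBit (2 * i) = true := by
  induction n with
  | zero => simp
  | succ n ih =>
    have h4 : evenBits (n + 1) = 2 ^ 2 * evenBits n + 1 := by
      have hdvd : 4 - 1 ∣ 4 ^ n - 1 := by simpa using Nat.sub_dvd_pow_sub_pow 4 1 n
      have hpos : 1 ≤ 4 ^ n := Nat.one_le_pow _ _ (by norm_num)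
      simp only [evenBits, pow_succ]
      omega
    intro i hi
    rw [h4, Nat.testBit_two_pow_mul_add _ (by norm_num)]
    cases i with
    | zero => rfl
    | succ i => simpa [Nat.mul_add] using ih i (by omega)

/-- A bit set containing the values `A^φ(n, 119 - i)` for the squares and
`n ≥ max 70 (119 - i)`. -/
def squareValueBits : ℕ → ℕ
  | 0 => evenBits 15015
  | i + 1 =>
    evalAt (squareValueBits i) fun s =>
      totientImageAux ((119 - i) ^ 2) 16 0 s (bif Nat.ble 70 (118 - i) then 1 <<< 16 else 0) >>> 16

theorem squareValueBits_eq : squareValueBits 119 = 2 ^ 16 := by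
  decide +kernel

/-- `scorePartial` for the squares, computed with `fastTotient`. -/
def fastSquarePartial (n : ℕ) : ℕ → ℕ
  | 0 => 0
  | j + 1 => evalAt (fastSquarePartial n j) fun x => fastTotient ((n - j) ^ 2 + x)

theorem fastSquarePartial_eq {n j : ℕ} (hj : j ≤ n) :
    fastSquarePartial n j = scorePartial (fun k => k ^ 2) n j := by
  induction j with
  | zero => rfl
  | succ j ih =>
    have : 1 ≤ (n - j) ^ 2 := Nat.one_le_pow _ _ (by omega)
    rw [fastSquarePartial, scorePartial, evalAt_eq, ih (by omega), fastTotient_eq (by omega)]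

theorem two_mul_totient_le_of_even (m : ℕ) (hm : Even m) : 2 * Nat.totient m ≤ m := by
  induction m using Nat.strong_induction_on with
  | _ m ih =>
    obtain ⟨q, rfl⟩ := hm.two_dvd
    rcases Nat.even_or_odd q with hq | hq
    · rw [Nat.totient_two_mul_of_even hq]
      rcases Nat.eq_zero_or_pos q with rfl | hq0
      · simp
      · have := ih q (by omega) hq
        omega
    · rw [Nat.totient_two_mul_of_odd hq]
      have := Nat.totient_le q
      omega

theorem even_scorePartial_squares {n j : ℕ} (hj : j < n) :
    Even (scorePartial (fun k => k ^ 2) n j) := by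
  cases j with
  | zero => simp [scorePartial]
  | succ j =>
    have : 2 ^ 2 ≤ (n - j) ^ 2 := Nat.pow_le_pow_left (by omega) 2
    exact Nat.totient_even (by dsimp only; omega)

theorem scorePartial_squares_le {n j k : ℕ} (hk : j + k = n) :
    (Even k → scorePartial (fun i => i ^ 2) n j ≤ 3 * k ^ 2 + 20 * k + 58) ∧
    (Odd k → scorePartial (fun i => i ^ 2) n j ≤ 2 * (k + 1) ^ 2 + 10 * (k + 1) + 29) := by
  induction j generalizing k with
  | zero => simp [scorePartial]
  | succ j ih =>
    obtain ⟨ihe, iho⟩ := ih (k := k + 1) (by omega)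
    have hnj : n - j = k + 1 := by omega
    simp only [scorePartial, hnj]
    constructor
    · intro hk'
      have h1 := iho hk'.add_one
      have h2 := Nat.totient_le ((k + 1) ^ 2 + scorePartial (fun i => i ^ 2) n j)
      nlinarith
    · intro hk'
      have h1 := ihe hk'.add_one
      have h2 := two_mul_totient_le_of_even
        ((k + 1) ^ 2 + scorePartial (fun i => i ^ 2) n j)
        ((hk'.add_one.pow_of_ne_zero two_ne_zero).add (even_scorePartial_squares (by omega)))
      nlinarith

theorem scorePartial_squares_lt {n j k : ℕ} (hk : j + k = n) (hk' : k ≤ 119) :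
    scorePartial (fun i => i ^ 2) n j < 2 ^ 16 := by
  obtain ⟨he, ho⟩ := scorePartial_squares_le hk
  rcases Nat.even_or_odd k with h | h
  · nlinarith [he h]
  · nlinarith [ho h]

theorem testBit_squareValueBits {n : ℕ} (hn : 70 ≤ n) (i : ℕ) (hi : i ≤ 119) :
    ∀ j, j + (119 - i) = n →
      (squareValueBits i).testBit (scorePartial (fun k => k ^ 2) n j) = true := by
  induction i with
  | zero =>
    intro j hj
    obtain ⟨q, hq⟩ := (even_scorePartial_squares (n := n) (j := j) (by omega)).two_dvd
    have := (scorePartial_squares_le hj).2 (by decide)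
    rw [squareValueBits, hq]
    exact testBit_evenBits _ _ (by omega)
  | succ i ih =>
    intro j hj
    rw [squareValueBits, evalAt_eq, Nat.testBit_shiftRight]
    cases j with
    | zero =>
      apply testBit_totientImageAux_of_acc
      rw [show Nat.ble 70 (118 - i) = true from Nat.ble_eq_true_of_le (by omega)]
      simp only [scorePartial, cond_true]
      decide
    | succ j =>
      have hnj : n - j = 119 - i := by omega
      have := testBit_totientImageAux ((119 - i) ^ 2) 16 (Nat.one_le_pow _ _ (by omega)) 0
        (squareValueBits i) (bif Nat.ble 70 (118 - i) then 1 <<< 16 else 0) _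
        (scorePartial_squares_lt (n := n) (j := j) (k := 119 - i) (by omega) (by omega))
        (ih (by omega) j (by omega))
      simpa only [scorePartial, hnj, add_zero] using this

theorem scorePartial_squares_of_ge {n : ℕ} (hn : 70 ≤ n) :
    scorePartial (fun k => k ^ 2) n n = 16 := by
  have h := testBit_squareValueBits hn 119 le_rfl n (by omega)
  rw [squareValueBits_eq, Nat.testBit_two_pow] at h
  exact (of_decide_eq_true h).symm

theorem fastSquarePartial_of_lt : ∀ n < 70, 1 ≤ n → fastSquarePartial n n =
      if n = 1 then 1
      else if n = 2 then 2
      else if n = 3 then 4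
      else if n = 4 ∨ n = 5 ∨ n = 6 then 6
      else if n ∈ ({9, 14, 15, 17, 24, 26, 30, 31, 32, 33, 34, 35, 38, 40, 47,
          53, 59, 69} : Finset ℕ) then 22
      else 16 := by
  decide +kernel

theorem stmt_11 (n : ℕ) (hn : 1 ≤ n) :
    scorePartial (fun j => j ^ 2) n n =
      if n = 1 then 1
      else if n = 2 then 2
      else if n = 3 then 4
      else if n = 4 ∨ n = 5 ∨ n = 6 then 6
      else if n ∈ ({9, 14, 15, 17, 24, 26, 30, 31, 32, 33, 34, 35, 38, 40, 47,
          53, 59, 69} : Finset ℕ) then 22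
      else 16 := by
  rcases Nat.lt_or_ge n 70 with h | h
  · rw [← fastSquarePartial_eq le_rfl]
    exact fastSquarePartial_of_lt n h hn
  · rw [scorePartial_squares_of_ge h]
    simp only [Finset.mem_insert, Finset.mem_singleton]
    split_ifs <;> omega
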